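/- Consider ẋ = f(t,x,u(t)) with f : ℝ≥0 × ℝⁿ × ℝᵏ → ℝⁿ continuous, a norm ‖·‖_X on ℝⁿ with compatible weak pairing ⟦·,·⟧_X satisfying the curve norm derivative formula, a norm ‖·‖_U on ℝᵏ, and constants c, ℓ > 0 such that ⟦f(t,x,u) − f(t,y,u), x − y⟧_X ≤ −c‖x − y‖_X² and ‖f(t,x,u) − f(t,x,v)‖_X ≤ ℓ‖u − v‖_U for all t, x, y, u, v. Then for every q ∈ [1,∞], any two solutions x(·), y(·) with continuous inputs u_x, u_y and equal initial conditions x(0) = y(0) satisfy ‖x(·) − y(·)‖_{X,q} ≤ (ℓ/c)·‖u_x(·) − u_y(·)‖_{U,q}, i.e., the system has incremental L^q gain bounded by ℓ/c. -/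

import Mathlib

open Filter Topology MeasureTheory

/-- The upper right Dini derivative `D⁺φ(t) = limsup_{h→0⁺} (φ(t+h)−φ(t))/h`. -/
noncomputable def DiniUpper (φ : ℝ → ℝ) (t : ℝ) : ℝ :=
  Filter.limsup (fun h : ℝ => (φ (t + h) - φ t) / h) (nhdsWithin 0 (Set.Ioi 0))

/-- `ν` is a norm on `ℝⁿ`. -/
structure IsNorm {n : ℕ} (ν : (Fin n → ℝ) → ℝ) : Prop where
  pos : ∀ x, x ≠ 0 → 0 < ν x
  homog : ∀ (a : ℝ) (x : Fin n → ℝ), ν (a • x) = |a| * ν x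
  triangle : ∀ x y, ν (x + y) ≤ ν x + ν y

/-- `P` is a weak pairing on `ℝⁿ`. -/
structure IsWeakPairing {n : ℕ} (P : (Fin n → ℝ) → (Fin n → ℝ) → ℝ) : Prop where
  subadd : ∀ x₁ x₂ y, P (x₁ + x₂) y ≤ P x₁ y + P x₂ y
  cont : ∀ y, Continuous fun x => P x y
  homog_left : ∀ (a : ℝ), 0 ≤ a → ∀ x y, P (a • x) y = a * P x y
  homog_right : ∀ (a : ℝ), 0 ≤ a → ∀ x y, P x (a • y) = a * P x y
  neg_neg : ∀ x y, P (-x) (-y) = P x y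
  posdef : ∀ x, x ≠ 0 → 0 < P x x
  cauchySchwarz : ∀ x y, |P x y| ≤ Real.sqrt (P x x) * Real.sqrt (P y y)

/-- A weak pairing `P` is compatible with the norm `ν`. -/
def Compatible {n : ℕ} (ν : (Fin n → ℝ) → ℝ)
    (P : (Fin n → ℝ) → (Fin n → ℝ) → ℝ) : Prop :=
  ∀ x, P x x = (ν x) ^ 2

/-- Deimling's inequality: `⟦x,y⟧ ≤ ‖y‖ · lim_{h→0⁺}(‖y+hx‖−‖y‖)/h`
(the one-sided limit exists for every norm). -/
def DeimlingIneq {n : ℕ} (ν : (Fin n → ℝ) → ℝ)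
    (P : (Fin n → ℝ) → (Fin n → ℝ) → ℝ) : Prop :=
  ∀ x y L, Filter.Tendsto (fun h : ℝ => (ν (y + h • x) - ν y) / h)
      (nhdsWithin 0 (Set.Ioi 0)) (nhds L) → P x y ≤ ν y * L

/-- The curve norm derivative formula: for any differentiable curve,
`‖x(t)‖ D⁺‖x(t)‖ = ⟦ẋ(t), x(t)⟧` for a.e. `t`. -/
def CurveNormDerivFormula {n : ℕ} (ν : (Fin n → ℝ) → ℝ)
    (P : (Fin n → ℝ) → (Fin n → ℝ) → ℝ) : Prop :=
  ∀ (a b : ℝ) (x x' : ℝ → Fin n → ℝ),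
    (∀ t ∈ Set.Ioo a b, HasDerivAt x (x' t) t) →
    ∀ᵐ t ∂(volume : Measure ℝ), t ∈ Set.Ioo a b →
      ν (x t) * DiniUpper (fun s => ν (x s)) t = P (x' t) (x t)

/-- The operator norm on matrices induced by the norm `ν` on `ℝⁿ`. -/
noncomputable def opNorm {n : ℕ} (ν : (Fin n → ℝ) → ℝ)
    (A : Matrix (Fin n) (Fin n) ℝ) : ℝ :=
  sSup ((fun x => ν (A.mulVec x)) '' {x | ν x = 1})

/-- `m` is the matrix measure of `A` induced by `ν`:
`m = lim_{h→0⁺} (‖I + hA‖ − 1)/h`. -/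
def HasMatrixMeasure {n : ℕ} (ν : (Fin n → ℝ) → ℝ)
    (A : Matrix (Fin n) (Fin n) ℝ) (m : ℝ) : Prop :=
  Filter.Tendsto
    (fun h : ℝ => (opNorm ν ((1 : Matrix (Fin n) (Fin n) ℝ) + h • A) - 1) / h)
    (nhdsWithin 0 (Set.Ioi 0)) (nhds m)

namespace IsNorm

variable {n : ℕ} {ν : (Fin n → ℝ) → ℝ}

protected lemma map_zero (h : IsNorm ν) : ν 0 = 0 := by
  simpa using h.homog 0 0

protected lemma nonneg (h : IsNorm ν) (x : Fin n → ℝ) : 0 ≤ ν x := by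
  by_cases hx : x = 0
  · rw [hx, h.map_zero]
  · exact (h.pos x hx).le

/-- A norm on `ℝⁿ` is Lipschitz with respect to the sup norm. -/
lemma exists_lipschitzWith (h : IsNorm ν) : ∃ K, LipschitzWith K ν := by
  let p : Seminorm ℝ (Fin n → ℝ) := Seminorm.of ν h.triangle h.homog
  have hle : ∀ x, ν x ≤ (∑ i, ν (Pi.single i 1)) * ‖x‖ := by
    intro x
    calc ν x = p (∑ i, x i • Pi.single i (1 : ℝ)) := by
          rw [← pi_eq_sum_univ' x]; rfl
      _ ≤ ∑ i, p (x i • Pi.single i (1 : ℝ)) := Finset.le_sum_of_subadditive p (map_zero p).le (map_add_le_add p) _ _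
      _ = ∑ i, |x i| * ν (Pi.single i 1) := Finset.sum_congr rfl fun i _ => h.homog _ _
      _ ≤ ∑ i, ‖x‖ * ν (Pi.single i 1) := by
          gcongr with i
          · exact h.nonneg _
          · exact norm_le_pi_norm x i
      _ = (∑ i, ν (Pi.single i 1)) * ‖x‖ := by rw [← Finset.mul_sum, mul_comm]
  refine ⟨⟨∑ i, ν (Pi.single i 1), Finset.sum_nonneg fun i _ => h.nonneg _⟩,
    LipschitzWith.of_le_add_mul _ fun x y => ?_⟩
  have h1 := h.triangle y (x - y)
  have h2 := hle (x - y)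
  rw [add_sub_cancel] at h1
  rw [dist_eq_norm]
  exact h1.trans (add_le_add_right h2 _)

protected lemma continuous (h : IsNorm ν) : Continuous ν :=
  h.exists_lipschitzWith.choose_spec.continuous

end IsNorm

lemma HasDerivAt.diniUpper_eq {φ : ℝ → ℝ} {d t : ℝ} (h : HasDerivAt φ d t) :
    DiniUpper φ t = d := by
  refine Tendsto.limsup_eq ?_
  have h1 := h.tendsto_slope_zero_right
  simpa [div_eq_inv_mul] using h1

/-- Bernoulli's inequality in homogeneous form. -/
lemma mul_rpow_sub_one_mul_le {q m s : ℝ} (hq : 1 ≤ q) (hm : 0 ≤ m) (hs : 0 ≤ s) :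
    q * m ^ (q - 1) * s ≤ (q - 1) * m ^ q + s ^ q := by
  rcases hm.eq_or_lt with rfl | hm
  · rcases hq.eq_or_lt with rfl | hq
    · simp
    · rw [Real.zero_rpow (by linarith), Real.zero_rpow (by linarith)]
      simpa using Real.rpow_nonneg hs q
  · have h1 := one_add_mul_self_le_rpow_one_add (s := s / m - 1)
      (by linarith [div_nonneg hs hm.le]) hq
    rw [add_sub_cancel, Real.div_rpow hs hm.le] at h1
    have hmq : 0 < m ^ q := Real.rpow_pos_of_pos hm q
    have h2 := mul_le_mul_of_nonneg_left h1 hmq.le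
    rw [mul_div_cancel₀ _ hmq.ne'] at h2
    have h3 : m ^ q * (s / m) = m ^ (q - 1) * s := by
      rw [Real.rpow_sub_one hm.ne']; ring
    linarith [congrArg (q * ·) h3]

/-- A function that is absolutely continuous on `[a, b]` grows by at most the integral of an
almost everywhere upper bound of its derivative. -/
lemma AbsolutelyContinuousOnInterval.sub_le_integral {F h : ℝ → ℝ} {a b : ℝ} (hab : a ≤ b)
    (hF : AbsolutelyContinuousOnInterval F a b) (hh : IntervalIntegrable h volume a b)
    (hle : ∀ᵐ t, t ∈ Set.Ioo a b → deriv F t ≤ h t) :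
    F b - F a ≤ ∫ t in a..b, h t := by
  rw [← hF.integral_deriv_eq_sub]
  refine intervalIntegral.integral_mono_ae_restrict hab hF.intervalIntegrable_deriv hh ?_
  rw [← Measure.restrict_congr_set Ioo_ae_eq_Icc]
  exact (ae_restrict_iff' measurableSet_Ioo).2 hle

lemma AbsolutelyContinuousOnInterval.rpow_const {F : ℝ → ℝ} {T q : ℝ} {K : NNReal} (hq : 1 ≤ q)
    (hF : LipschitzOnWith K F (Set.uIcc 0 T)) :
    AbsolutelyContinuousOnInterval (fun t => F t ^ q) 0 T := by
  have hcomp : IsCompact (F '' Set.uIcc 0 T) := isCompact_uIcc.image_of_continuousOn hF.continuousOn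
  have hrpow : ContDiff ℝ 1 fun x : ℝ => x ^ q :=
    mod_cast Real.contDiff_rpow_const_of_le (n := 1) (mod_cast hq)
  obtain ⟨L, hL⟩ := LocallyLipschitzOn.exists_lipschitzOnWith_of_compact hcomp
    hrpow.locallyLipschitz.locallyLipschitzOn
  exact (hL.comp hF (Set.mapsTo_image _ _)).absolutelyContinuousOnInterval

/-- The differential inequality `m' ≤ -c m + γ`, holding almost everywhere on `(0, T)` for
a nonnegative Lipschitz `m` with `m 0 = 0`, bounds the `q`-th moment of `m`. -/
lemma integral_rpow_le_of_deriv_le {m γ : ℝ → ℝ} {c T q : ℝ} {K : NNReal} (hc : 0 < c)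
    (hT : 0 ≤ T) (hq : 1 ≤ q) (hm : ∀ t, 0 ≤ m t) (hγ : ∀ t, 0 ≤ γ t) (hγc : Continuous γ)
    (hm0 : m 0 = 0) (hLip : LipschitzOnWith K m (Set.uIcc 0 T))
    (hd : ∀ᵐ t, t ∈ Set.Ioo 0 T → ∃ d, HasDerivAt m d t ∧ d ≤ -c * m t + γ t) :
    ∫ t in 0..T, m t ^ q ≤ ∫ t in 0..T, (γ t / c) ^ q := by
  have hq0 : 0 ≤ q := by linarith
  have hmi : IntervalIntegrable (fun t => m t ^ q) volume 0 T :=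
    (hLip.continuousOn.rpow_const fun t _ => Or.inr hq0).intervalIntegrable
  have hgi : IntervalIntegrable (fun t => (γ t / c) ^ q) volume 0 T :=
    ((hγc.div_const c).rpow_const fun t => Or.inr hq0).intervalIntegrable _ _
  have key := AbsolutelyContinuousOnInterval.sub_le_integral hT
    (AbsolutelyContinuousOnInterval.rpow_const hq hLip) ((hgi.sub hmi).const_mul c) (by
      filter_upwards [hd] with t ht htT
      obtain ⟨d, hd, hdle⟩ := ht htT
      rw [(hd.rpow_const (Or.inr hq)).deriv]
      have hpow : m t * m t ^ (q - 1) = m t ^ q := by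
        rw [mul_comm]
        rcases (hm t).eq_or_lt with h | h
        · rw [← h, Real.zero_rpow (by linarith : q ≠ 0), mul_zero]
        · rw [Real.rpow_sub_one h.ne', div_mul_cancel₀ _ h.ne']
      have hpos : 0 ≤ q * m t ^ (q - 1) := mul_nonneg hq0 (Real.rpow_nonneg (hm t) _)
      have hY := mul_rpow_sub_one_mul_le hq (hm t) (div_nonneg (hγ t) hc.le)
      calc d * q * m t ^ (q - 1) = q * m t ^ (q - 1) * d := by ring
        _ ≤ q * m t ^ (q - 1) * (-c * m t + γ t) := mul_le_mul_of_nonneg_left hdle hpos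
        _ = c * (q * m t ^ (q - 1) * (γ t / c) - q * (m t * m t ^ (q - 1))) := by
            field_simp; ring
        _ ≤ c * ((γ t / c) ^ q - m t ^ q) := by
            rw [hpow]
            exact mul_le_mul_of_nonneg_left (by linarith) hc.le)
  rw [intervalIntegral.integral_const_mul, intervalIntegral.integral_sub hgi hmi, hm0,
    Real.zero_rpow (by linarith : q ≠ 0), sub_zero] at key
  have h1 := (Real.rpow_nonneg (hm T) q).trans key
  linarith [nonneg_of_mul_nonneg_right h1 hc]

/-- The differential inequality `m' ≤ -c m + γ` with `γ ≤ B`, holding almost everywhere on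
`(0, T)` for a Lipschitz `m` with `m 0 = 0`, gives `m T ≤ B / c`. -/
lemma le_div_of_deriv_le {m γ : ℝ → ℝ} {c T B : ℝ} {K : NNReal} (hc : 0 < c)
    (hT : 0 ≤ T) (hB : 0 ≤ B) (hγB : ∀ t, 0 ≤ t → γ t ≤ B)
    (hm0 : m 0 = 0) (hLip : LipschitzOnWith K m (Set.uIcc 0 T))
    (hd : ∀ᵐ t, t ∈ Set.Ioo 0 T → ∃ d, HasDerivAt m d t ∧ d ≤ -c * m t + γ t) :
    m T ≤ B / c := by
  have hexp : ContDiff ℝ 1 fun t : ℝ => Real.exp (c * t) := by fun_prop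
  have hexpAC : AbsolutelyContinuousOnInterval (fun t => Real.exp (c * t)) 0 T :=
    hexp.contDiffOn.absolutelyContinuousOnInterval
  have hder : ∀ t : ℝ, HasDerivAt (fun t => Real.exp (c * t)) (Real.exp (c * t) * c) t := by
    intro t
    simpa using ((hasDerivAt_id t).const_mul c).exp
  have hcont : Continuous fun t : ℝ => Real.exp (c * t) * c * (B / c) := by fun_prop
  have key := (hexpAC.fun_mul hLip.absolutelyContinuousOnInterval).sub_le_integral hT
    (hcont.intervalIntegrable 0 T) (by
      filter_upwards [hd] with t ht htT
      obtain ⟨d, hd, hdle⟩ := ht htT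
      rw [((hder t).fun_mul hd).deriv]
      have h1 : d ≤ -c * m t + B := by linarith [hγB t htT.1.le]
      calc _ ≤ Real.exp (c * t) * c * m t + Real.exp (c * t) * (-c * m t + B) := by gcongr
        _ = Real.exp (c * t) * c * (B / c) := by field_simp; ring)
  rw [intervalIntegral.integral_mul_const, intervalIntegral.integral_eq_sub_of_hasDerivAt
    (fun t _ => hder t) ((by fun_prop : Continuous fun t : ℝ =>
      Real.exp (c * t) * c).intervalIntegrable _ _), hm0] at key
  have h2 : Real.exp (c * T) * m T ≤ Real.exp (c * T) * (B / c) := by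
    have : 0 ≤ B / c := by positivity
    simp only [mul_zero, Real.exp_zero] at key
    linarith
  exact le_of_mul_le_mul_left h2 (Real.exp_pos _)

lemma lintegral_Ioi_rpow_le {m g : ℝ → ℝ} {q : ℝ} (hq : 0 ≤ q) (hm : ∀ t, 0 ≤ m t)
    (hg : ∀ t, 0 ≤ g t) (hmc : ContinuousOn m (Set.Ici 0)) (hgc : Continuous g)
    (hle : ∀ T, 0 ≤ T → ∫ t in 0..T, m t ^ q ≤ ∫ t in 0..T, g t ^ q) :
    ∫⁻ t in Set.Ioi (0 : ℝ), ENNReal.ofReal (m t) ^ q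
      ≤ ∫⁻ t in Set.Ioi (0 : ℝ), ENNReal.ofReal (g t) ^ q := by
  have hmq : ContinuousOn (fun t => m t ^ q) (Set.Ici 0) :=
    hmc.rpow_const fun t _ => Or.inr hq
  have hgq : Continuous fun t => g t ^ q := hgc.rpow_const fun t => Or.inr hq
  simp only [ENNReal.ofReal_rpow_of_nonneg (hm _) hq, ENNReal.ofReal_rpow_of_nonneg (hg _) hq]
  have hmeas : AEMeasurable (fun t => ENNReal.ofReal (m t ^ q))
      (volume.restrict (Set.Ioi (0 : ℝ))) :=
    ((hmq.mono Set.Ioi_subset_Ici_self).aemeasurable measurableSet_Ioi).ennreal_ofReal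
  refine le_of_tendsto ((aecover_Iic tendsto_id).lintegral_tendsto_of_countably_generated hmeas)
    ((eventually_ge_atTop 0).mono fun T hT => ?_)
  rw [Measure.restrict_restrict measurableSet_Iic, Set.Iic_inter_Ioi]
  have hmi : IntervalIntegrable (fun t => m t ^ q) volume 0 T :=
    (hmq.mono (by rw [Set.uIcc_of_le hT]; exact Set.Icc_subset_Ici_self)).intervalIntegrable
  have hgi : IntervalIntegrable (fun t => g t ^ q) volume 0 T := hgq.intervalIntegrable _ _
  have h := hle T hT
  rw [intervalIntegral.integral_of_le hT, intervalIntegral.integral_of_le hT] at h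
  calc ∫⁻ t in Set.Ioc 0 T, ENNReal.ofReal (m t ^ q)
      = ENNReal.ofReal (∫ t in Set.Ioc 0 T, m t ^ q) :=
        (ofReal_integral_eq_lintegral_ofReal hmi.1
          (ae_of_all _ fun t => Real.rpow_nonneg (hm t) q)).symm
    _ ≤ ENNReal.ofReal (∫ t in Set.Ioc 0 T, g t ^ q) := ENNReal.ofReal_le_ofReal h
    _ = ∫⁻ t in Set.Ioc 0 T, ENNReal.ofReal (g t ^ q) :=
        ofReal_integral_eq_lintegral_ofReal hgi.1
          (ae_of_all _ fun t => Real.rpow_nonneg (hg t) q)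
    _ ≤ _ := lintegral_mono_set Set.Ioc_subset_Ioi_self

/-- A curve with continuous derivative on `[0, T]` has Lipschitz norm there. -/
lemma IsNorm.exists_lipschitzOnWith_comp {n : ℕ} {ν : (Fin n → ℝ) → ℝ} (h : IsNorm ν)
    {w w' : ℝ → Fin n → ℝ} {T : ℝ} (hT : 0 ≤ T)
    (hw : ∀ t, 0 ≤ t → HasDerivAt w (w' t) t) (hw' : ContinuousOn w' (Set.Ici 0)) :
    ∃ K, LipschitzOnWith K (fun t => ν (w t)) (Set.uIcc 0 T) := by
  rw [Set.uIcc_of_le hT]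
  obtain ⟨C, hC⟩ := isCompact_Icc.exists_bound_of_continuousOn
    (hw'.mono (Set.Icc_subset_Ici_self : Set.Icc 0 T ⊆ Set.Ici 0))
  obtain ⟨K, hK⟩ := h.exists_lipschitzWith
  have hL : LipschitzOnWith C.toNNReal w (Set.Icc 0 T) :=
    (convex_Icc 0 T).lipschitzOnWith_of_nnnorm_hasDerivWithin_le
      (fun t ht => (hw t ht.1).hasDerivWithinAt) fun t ht => by
        rw [← norm_toNNReal]
        exact Real.toNNReal_le_toNNReal (hC t ht)
  exact ⟨_, hK.comp_lipschitzOnWith hL⟩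

/-- Almost everywhere bound for the derivative of the norm of a curve, given a bound for its
pairing with its velocity. -/
lemma CurveNormDerivFormula.ae_hasDerivAt_le {n : ℕ} {ν : (Fin n → ℝ) → ℝ}
    {P : (Fin n → ℝ) → (Fin n → ℝ) → ℝ} (hC : CurveNormDerivFormula ν P) (hν : IsNorm ν)
    {w w' : ℝ → Fin n → ℝ} {γ : ℝ → ℝ} {c T : ℝ} {K : NNReal} (hT : 0 ≤ T)
    (hγ : ∀ t, 0 ≤ γ t) (hw : ∀ t, 0 ≤ t → HasDerivAt w (w' t) t)
    (hLip : LipschitzOnWith K (fun t => ν (w t)) (Set.uIcc 0 T))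
    (hP : ∀ t, 0 ≤ t → P (w' t) (w t) ≤ -c * ν (w t) ^ 2 + γ t * ν (w t)) :
    ∀ᵐ t, t ∈ Set.Ioo 0 T →
      ∃ d, HasDerivAt (fun t => ν (w t)) d t ∧ d ≤ -c * ν (w t) + γ t := by
  filter_upwards [hC 0 T w w' fun t ht => hw t ht.1.le,
    hLip.absolutelyContinuousOnInterval.ae_differentiableAt] with t hform hdiff ht
  have hder := (hdiff (by rw [Set.uIcc_of_le hT]; exact Set.Ioo_subset_Icc_self ht)).hasDerivAt
  refine ⟨_, hder, ?_⟩
  rcases (hν.nonneg (w t)).eq_or_lt with h0 | hpos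
  · have hmin : IsLocalMin (fun t => ν (w t)) t :=
      Eventually.of_forall fun s => by
        simpa only [← h0] using hν.nonneg (w s)
    rw [hmin.deriv_eq_zero, ← h0]
    simpa using hγ t
  · have h1 := hform ht
    rw [hder.diniUpper_eq] at h1
    refine le_of_mul_le_mul_left ?_ hpos
    calc _ = P (w' t) (w t) := h1
      _ ≤ _ := hP t ht.1.le
      _ = _ := by ring

/-- Theorem 39 (iii): a strongly contracting system with inputs has incremental
`L^q` gain bounded by `ℓ/c`, for every `q ∈ [1,∞]` (the case `q = ∞` is stated
separately via the supremum norm). -/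
theorem incremental_Lq_gain_of_contracting {n k : ℕ}
    (f : ℝ → (Fin n → ℝ) → (Fin k → ℝ) → Fin n → ℝ)
    (νX : (Fin n → ℝ) → ℝ) (PX : (Fin n → ℝ) → (Fin n → ℝ) → ℝ)
    (νU : (Fin k → ℝ) → ℝ) (c ℓ : ℝ)
    (hf : Continuous fun p : ℝ × (Fin n → ℝ) × (Fin k → ℝ) => f p.1 p.2.1 p.2.2)
    (hνX : IsNorm νX) (hPX : IsWeakPairing PX) (hcomp : Compatible νX PX)
    (hCNDF : CurveNormDerivFormula νX PX) (hνU : IsNorm νU)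
    (hc : 0 < c) (hℓ : 0 < ℓ)
    (hA1 : ∀ t, 0 ≤ t → ∀ (x y : Fin n → ℝ) (u : Fin k → ℝ),
      PX (f t x u - f t y u) (x - y) ≤ -c * νX (x - y) ^ 2)
    (hA2 : ∀ t, 0 ≤ t → ∀ (x : Fin n → ℝ) (u v : Fin k → ℝ),
      νX (f t x u - f t x v) ≤ ℓ * νU (u - v))
    -- two solutions with continuous inputs and the same initial condition
    (x y : ℝ → Fin n → ℝ) (ux uy : ℝ → Fin k → ℝ)
    (hux : Continuous ux) (huy : Continuous uy)
    (hx : ∀ t, 0 ≤ t → HasDerivAt x (f t (x t) (ux t)) t)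
    (hy : ∀ t, 0 ≤ t → HasDerivAt y (f t (y t) (uy t)) t)
    (h0 : x 0 = y 0) :
    -- finite `q ∈ [1,∞)`
    (∀ q : ℝ, 1 ≤ q →
      (∫⁻ t in Set.Ioi (0 : ℝ), ENNReal.ofReal (νX (x t - y t)) ^ q) ^ (1 / q)
        ≤ ENNReal.ofReal (ℓ / c) *
          (∫⁻ t in Set.Ioi (0 : ℝ), ENNReal.ofReal (νU (ux t - uy t)) ^ q) ^ (1 / q)) ∧
    -- `q = ∞`
    (⨆ t ∈ Set.Ici (0 : ℝ), ENNReal.ofReal (νX (x t - y t)))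
      ≤ ENNReal.ofReal (ℓ / c) *
        ⨆ t ∈ Set.Ici (0 : ℝ), ENNReal.ofReal (νU (ux t - uy t)) := by
  set w : ℝ → Fin n → ℝ := fun t => x t - y t with hw_def
  set w' : ℝ → Fin n → ℝ := fun t => f t (x t) (ux t) - f t (y t) (uy t) with hw'_def
  set g : ℝ → ℝ := fun t => νU (ux t - uy t) with hg_def
  have hw : ∀ t, 0 ≤ t → HasDerivAt w (w' t) t := fun t ht => (hx t ht).sub (hy t ht)
  have hxc : ContinuousOn x (Set.Ici 0) := fun t ht =>
    (hx t ht).continuousAt.continuousWithinAt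
  have hyc : ContinuousOn y (Set.Ici 0) := fun t ht =>
    (hy t ht).continuousAt.continuousWithinAt
  have hw'c : ContinuousOn w' (Set.Ici 0) :=
    (hf.comp_continuousOn (continuousOn_id.prodMk (hxc.prodMk hux.continuousOn))).sub
      (hf.comp_continuousOn (continuousOn_id.prodMk (hyc.prodMk huy.continuousOn)))
  have hg : ∀ t, 0 ≤ g t := fun t => hνU.nonneg _
  have hγ : ∀ t, 0 ≤ ℓ * g t := fun t => mul_nonneg hℓ.le (hg t)
  have hgc : Continuous g := hνU.continuous.comp (hux.sub huy)
  have hm : ∀ t, 0 ≤ νX (w t) := fun t => hνX.nonneg _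
  have hm0 : νX (w 0) = 0 := by simp only [hw_def, h0, sub_self, hνX.map_zero]
  have hP : ∀ t, 0 ≤ t → PX (w' t) (w t) ≤ -c * νX (w t) ^ 2 + ℓ * g t * νX (w t) := by
    intro t ht
    have hsplit : w' t = (f t (x t) (ux t) - f t (y t) (ux t)) +
        (f t (y t) (ux t) - f t (y t) (uy t)) := (sub_add_sub_cancel _ _ _).symm
    rw [hsplit]
    refine (hPX.subadd _ _ _).trans (add_le_add (hA1 t ht _ _ _) ?_)
    have hCS := (le_abs_self _).trans
      (hPX.cauchySchwarz (f t (y t) (ux t) - f t (y t) (uy t)) (w t))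
    rw [hcomp, hcomp, Real.sqrt_sq (hνX.nonneg _), Real.sqrt_sq (hνX.nonneg _)] at hCS
    exact hCS.trans (mul_le_mul_of_nonneg_right (hA2 t ht _ _ _) (hm t))
  have hae : ∀ T, 0 ≤ T → ∃ K, LipschitzOnWith K (fun t => νX (w t)) (Set.uIcc 0 T) ∧
      ∀ᵐ t, t ∈ Set.Ioo 0 T →
        ∃ d, HasDerivAt (fun t => νX (w t)) d t ∧ d ≤ -c * νX (w t) + ℓ * g t := by
    intro T hT
    obtain ⟨K, hK⟩ := hνX.exists_lipschitzOnWith_comp hT hw hw'c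
    exact ⟨K, hK, hCNDF.ae_hasDerivAt_le hνX hT hγ hw hK hP⟩
  refine ⟨fun q hq => ?_, ?_⟩
  · have hq0 : 0 < q := by linarith
    have hmain : ∫⁻ t in Set.Ioi (0 : ℝ), ENNReal.ofReal (νX (w t)) ^ q
        ≤ ∫⁻ t in Set.Ioi (0 : ℝ), ENNReal.ofReal (ℓ * g t / c) ^ q := by
      refine lintegral_Ioi_rpow_le hq0.le hm (fun t => div_nonneg (hγ t) hc.le)
        (hνX.continuous.comp_continuousOn (hxc.sub hyc)) (by fun_prop) fun T hT => ?_
      obtain ⟨K, hK, hd⟩ := hae T hT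
      exact integral_rpow_le_of_deriv_le hc hT hq hm hγ (by fun_prop) hm0 hK hd
    have hfac : ∀ t, ENNReal.ofReal (ℓ * g t / c) ^ q
        = ENNReal.ofReal (ℓ / c) ^ q * ENNReal.ofReal (g t) ^ q := fun t => by
      rw [mul_div_right_comm, ENNReal.ofReal_mul (by positivity),
        ENNReal.mul_rpow_of_nonneg _ _ hq0.le]
    simp only [hfac] at hmain
    rw [lintegral_const_mul' _ _ (ENNReal.rpow_ne_top_of_nonneg hq0.le ENNReal.ofReal_ne_top)]
      at hmain
    refine (ENNReal.rpow_le_rpow hmain (by positivity)).trans_eq ?_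
    rw [ENNReal.mul_rpow_of_nonneg _ _ (by positivity), ← ENNReal.rpow_mul,
      mul_one_div_cancel hq0.ne', ENNReal.rpow_one]
  · set G : ENNReal := ⨆ t ∈ Set.Ici (0 : ℝ), ENNReal.ofReal (g t) with hG
    have hℓc : ENNReal.ofReal (ℓ / c) ≠ 0 := by
      rw [Ne, ENNReal.ofReal_eq_zero, not_le]
      positivity
    by_cases hGtop : G = ⊤
    · rw [hGtop, ENNReal.mul_top hℓc]
      exact le_top
    refine iSup₂_le fun T hT => ?_
    have hgG : ∀ t, 0 ≤ t → ℓ * g t ≤ ℓ * G.toReal := fun t ht =>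
      mul_le_mul_of_nonneg_left ((ENNReal.ofReal_le_iff_le_toReal hGtop).1
        (le_iSup₂_of_le t ht le_rfl)) hℓ.le
    obtain ⟨K, hK, hd⟩ := hae T hT
    have hbound := le_div_of_deriv_le hc hT (by positivity) hgG hm0 hK hd
    calc ENNReal.ofReal (νX (w T)) ≤ ENNReal.ofReal (ℓ / c * G.toReal) :=
          ENNReal.ofReal_le_ofReal (hbound.trans_eq (mul_div_right_comm _ _ _))
      _ = ENNReal.ofReal (ℓ / c) * G := by
          rw [ENNReal.ofReal_mul (by positivity), ENNReal.ofReal_toReal hGtop]
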